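/- arXiv:1507.05480 — 11 statements merged into one kernel-verified Lean document; each statement's English description precedes it below -/
import Mathlib

section
/- (Grioli's theorem.) Let n ≥ 2 and let F ∈ GL⁺(n). Then the polar factor polar(F) is the unique minimizer of R ↦ ‖RᵀF − 𝟙‖² over SO(n): for every R ∈ SO(n) one has ‖RᵀF − 𝟙‖² ≥ ‖U(F) − 𝟙‖², with equality if and only if R = polar(F). In particular min_{R ∈ SO(n)} ‖RᵀF − 𝟙‖² = ‖U(F) − 𝟙‖². -/
open Matrix Real

noncomputable section

/-- Squared Frobenius norm: `‖X‖² = tr (Xᵀ X)`. -/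
def frobSq {n : ℕ} (X : Matrix (Fin n) (Fin n) ℝ) : ℝ := Matrix.trace (Xᵀ * X)

/-- The special orthogonal group as a set of matrices. -/
def SO (n : ℕ) : Set (Matrix (Fin n) (Fin n) ℝ) := {R | Rᵀ * R = 1 ∧ R.det = 1}

/-- Symmetric part of a matrix. -/
def symPart {n : ℕ} (X : Matrix (Fin n) (Fin n) ℝ) : Matrix (Fin n) (Fin n) ℝ :=
  (1 / 2 : ℝ) • (X + Xᵀ)

/-- Skew-symmetric part of a matrix. -/
def skewPart {n : ℕ} (X : Matrix (Fin n) (Fin n) ℝ) : Matrix (Fin n) (Fin n) ℝ :=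
  (1 / 2 : ℝ) • (X - Xᵀ)

/-- The Cosserat shear-stretch energy `W_{μ,μc}(R; F)`. -/
def W (μ μc : ℝ) {n : ℕ} (R F : Matrix (Fin n) (Fin n) ℝ) : ℝ :=
  μ * frobSq (symPart (Rᵀ * F - 1)) + μc * frobSq (skewPart (Rᵀ * F - 1))

/-- The planar rotation by angle `α`. -/
def rot (α : ℝ) : Matrix (Fin 2) (Fin 2) ℝ :=
  !![Real.cos α, -Real.sin α; Real.sin α, Real.cos α]


/-- For a positive definite `U`, the map `B ↦ tr (B U Bᵀ)` is nonnegative. -/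
theorem trace_mul_mul_transpose_nonneg {n : ℕ} {U : Matrix (Fin n) (Fin n) ℝ} (hU : U.PosDef)
    (B : Matrix (Fin n) (Fin n) ℝ) : 0 ≤ (B * U * Bᵀ).trace := by
  simpa using (hU.posSemidef.mul_mul_conjTranspose_same B).trace_nonneg

/-- For a positive definite `U`, the trace of `B U Bᵀ` vanishes only at `B = 0`. -/
theorem trace_mul_mul_transpose_eq_zero_iff {n : ℕ} {U : Matrix (Fin n) (Fin n) ℝ}
    (hU : U.PosDef) (B : Matrix (Fin n) (Fin n) ℝ) : (B * U * Bᵀ).trace = 0 ↔ B = 0 := by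
  refine ⟨fun h => ?_, fun h => by simp [h]⟩
  have hz : B * U * Bᵀ = 0 := by
    simpa using
      (hU.posSemidef.mul_mul_conjTranspose_same B).trace_eq_zero_iff.1 (by simpa using h)
  ext i j
  by_contra hij
  have hne : B.row i ≠ 0 := fun h0 => hij (congrFun h0 j)
  have hii : (B * U * Bᵀ) i i = star (B.row i) ⬝ᵥ U *ᵥ B.row i := by
    rw [mul_assoc, star_trivial]
    rfl
  have hpos := hU.dotProduct_mulVec_pos hne
  rw [← hii, hz] at hpos
  exact lt_irrefl _ hpos

/-- Excess of the energy at `R` over its value at an orthogonal `P`, where `F = P U`. -/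
theorem frobSq_transpose_mul_sub_one {n : ℕ} {P R U : Matrix (Fin n) (Fin n) ℝ}
    (hP : Pᵀ * P = 1) (hR : Rᵀ * R = 1) (hU : Uᵀ = U) :
    frobSq (Rᵀ * (P * U) - 1) = frobSq (U - 1) + ((P - R) * U * (P - R)ᵀ).trace := by
  have hR' : R * Rᵀ = 1 := mul_eq_one_comm.1 hR
  have h1 : (P * U * Pᵀ).trace = U.trace := by
    rw [trace_mul_comm, ← mul_assoc, hP, one_mul]
  have h2 : (R * U * Rᵀ).trace = U.trace := by
    rw [trace_mul_comm, ← mul_assoc, hR, one_mul]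
  have h3 : (P * U * Rᵀ).trace = (Rᵀ * (P * U)).trace := trace_mul_comm _ _
  have h4 : (R * U * Pᵀ).trace = (Rᵀ * (P * U)).trace := by
    rw [← trace_transpose, ← h3]
    simp [transpose_mul, hU, mul_assoc]
  have h5 : (Rᵀ * (P * U))ᵀ * (Rᵀ * (P * U)) = U * U := by
    calc (Rᵀ * (P * U))ᵀ * (Rᵀ * (P * U)) = U * (Pᵀ * (R * Rᵀ) * P) * U := by
          simp only [transpose_mul, transpose_transpose, hU, mul_assoc]
      _ = U * U := by rw [hR', mul_one, hP, mul_one]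
  have h6 : ((Rᵀ * (P * U))ᵀ).trace = (Rᵀ * (P * U)).trace := trace_transpose _
  simp only [frobSq, transpose_sub, transpose_one, sub_mul, mul_sub, mul_one, one_mul, trace_sub,
    h1, h2, h3, h4, h5, h6, hU]
  ring

/-- **Grioli's theorem.** For n ≥ 2 and F ∈ GL⁺(n), the polar factor
polar(F) = F · U(F)⁻¹ is the unique minimizer of R ↦ ‖RᵀF − 𝟙‖² over SO(n),
where U(F) is the unique symmetric positive definite square root of FᵀF. -/
theorem grioli (n : ℕ) (hn : 2 ≤ n) (F : Matrix (Fin n) (Fin n) ℝ) (hF : 0 < F.det)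
    (U : Matrix (Fin n) (Fin n) ℝ) (hUpos : U.PosDef) (hUsq : U * U = Fᵀ * F) :
    (∀ R ∈ SO n, frobSq (U - 1) ≤ frobSq (Rᵀ * F - 1)) ∧
    (∀ R ∈ SO n, frobSq (Rᵀ * F - 1) = frobSq (U - 1) ↔ R = F * U⁻¹) := by
  have hUt : Uᵀ = U := by simpa using hUpos.isHermitian.eq
  have hdet : IsUnit U.det := hUpos.det_pos.ne'.isUnit
  have hP : (F * U⁻¹)ᵀ * (F * U⁻¹) = 1 := by
    calc (F * U⁻¹)ᵀ * (F * U⁻¹) = U⁻¹ * (Fᵀ * F) * U⁻¹ := by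
          simp only [transpose_mul, transpose_nonsing_inv, hUt, mul_assoc]
      _ = (U⁻¹ * U) * (U * U⁻¹) := by rw [← hUsq]; simp only [mul_assoc]
      _ = 1 := by rw [nonsing_inv_mul _ hdet, mul_nonsing_inv _ hdet, one_mul]
  have key : ∀ R ∈ SO n, frobSq (Rᵀ * F - 1) =
      frobSq (U - 1) + ((F * U⁻¹ - R) * U * (F * U⁻¹ - R)ᵀ).trace := fun R hR => by
    rw [← frobSq_transpose_mul_sub_one hP hR.1 hUt, nonsing_inv_mul_cancel_right _ _ hdet]
  refine ⟨fun R hR => ?_, fun R hR => ?_⟩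
  · rw [key R hR]
    exact le_add_of_nonneg_right (trace_mul_mul_transpose_nonneg hUpos _)
  · rw [key R hR, add_eq_left, trace_mul_mul_transpose_eq_zero_iff hUpos, sub_eq_zero, eq_comm]
end
end

section
/- (Parameter reduction, non-classical range.) Let n ≥ 2, let F ∈ GL⁺(n), and let μ, μc ∈ ℝ with μ > μc ≥ 0. Set F̃ := ((μ − μc)/μ)·F ∈ GL⁺(n). Then the set of minimizers of R ↦ W_{μ,μc}(R;F) over SO(n) coincides with the set of minimizers of R ↦ W_{1,0}(R;F̃) over SO(n): for every R₀ ∈ SO(n), (∀ R ∈ SO(n), W_{μ,μc}(R₀;F) ≤ W_{μ,μc}(R;F)) if and only if (∀ R ∈ SO(n), W_{1,0}(R₀;F̃) ≤ W_{1,0}(R;F̃)). -/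
open Matrix Real

noncomputable section

theorem frobSq_symPart_sub_one {n : ℕ} (X : Matrix (Fin n) (Fin n) ℝ) :
    frobSq (symPart (X - 1)) = (frobSq X + trace (X * X)) / 2 - 2 * trace X + n := by
  have h₁ : trace (Xᵀ * Xᵀ) = trace (X * X) := by
    rw [← transpose_mul, trace_transpose]
  simp only [frobSq, symPart, transpose_smul, transpose_add, transpose_sub, transpose_one,
    transpose_transpose, smul_mul_assoc, mul_smul_comm, mul_add, add_mul, mul_sub, sub_mul,
    mul_one, one_mul, trace_smul, trace_add, trace_sub, trace_transpose, trace_one, h₁,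
    trace_mul_comm X Xᵀ, Fintype.card_fin, smul_eq_mul]
  ring

theorem frobSq_skewPart_sub_one {n : ℕ} (X : Matrix (Fin n) (Fin n) ℝ) :
    frobSq (skewPart (X - 1)) = (frobSq X - trace (X * X)) / 2 := by
  have h₁ : trace (Xᵀ * Xᵀ) = trace (X * X) := by
    rw [← transpose_mul, trace_transpose]
  simp only [frobSq, skewPart, transpose_smul, transpose_sub, transpose_one,
    transpose_transpose, smul_mul_assoc, mul_smul_comm, mul_sub, sub_mul,
    mul_one, one_mul, trace_smul, trace_sub, trace_transpose, trace_one, h₁,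
    trace_mul_comm X Xᵀ, Fintype.card_fin, smul_eq_mul]
  ring

theorem frobSq_transpose_mul {n : ℕ} {R : Matrix (Fin n) (Fin n) ℝ} (hR : R ∈ SO n)
    (F : Matrix (Fin n) (Fin n) ℝ) : frobSq (Rᵀ * F) = frobSq F := by
  have h : R * Rᵀ = 1 := mul_eq_one_comm.mp hR.1
  rw [frobSq, frobSq, transpose_mul, transpose_transpose, Matrix.mul_assoc,
    ← Matrix.mul_assoc R, h, Matrix.one_mul]

theorem W_eq {n : ℕ} {R : Matrix (Fin n) (Fin n) ℝ} (hR : R ∈ SO n)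
    (F : Matrix (Fin n) (Fin n) ℝ) (μ μc : ℝ) :
    W μ μc R F = (μ - μc) / 2 * trace (Rᵀ * F * (Rᵀ * F)) - 2 * μ * trace (Rᵀ * F) +
      ((μ + μc) / 2 * frobSq F + μ * n) := by
  rw [W, frobSq_symPart_sub_one, frobSq_skewPart_sub_one, frobSq_transpose_mul hR]
  ring

/-- On `SO n`, the reduced energy of the rescaled matrix is a multiple of the full energy, up to
a constant that does not depend on the rotation. -/
theorem W_one_zero_smul {n : ℕ} {R : Matrix (Fin n) (Fin n) ℝ} (hR : R ∈ SO n)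
    (F : Matrix (Fin n) (Fin n) ℝ) {μ : ℝ} (hμ : μ ≠ 0) (μc : ℝ) :
    W 1 0 R (((μ - μc) / μ) • F) = (μ - μc) / μ ^ 2 * W μ μc R F +
      (1 / 2 * frobSq (((μ - μc) / μ) • F) + n -
        (μ - μc) / μ ^ 2 * ((μ + μc) / 2 * frobSq F + μ * n)) := by
  simp only [W_eq hR, mul_smul_comm, smul_mul_assoc, trace_smul, smul_eq_mul]
  field_simp
  ring


/-- **Parameter reduction, non-classical range μ > μc ≥ 0.** The minimizers of
R ↦ W_{μ,μc}(R;F) over SO(n) coincide with those of R ↦ W_{1,0}(R; F̃), where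
F̃ = ((μ − μc)/μ) • F. -/
theorem parameter_reduction_nonclassical (n : ℕ) (hn : 2 ≤ n)
    (F : Matrix (Fin n) (Fin n) ℝ) (hF : 0 < F.det)
    (μ μc : ℝ) (hμc : 0 ≤ μc) (hμ : μc < μ) :
    ∀ R₀ ∈ SO n,
      ((∀ R ∈ SO n, W μ μc R₀ F ≤ W μ μc R F) ↔
       (∀ R ∈ SO n, W 1 0 R₀ (((μ - μc) / μ) • F) ≤ W 1 0 R (((μ - μc) / μ) • F))) := by
  intro R₀ hR₀
  have hpos : 0 < μ := hμc.trans_lt hμ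
  have hc : 0 < (μ - μc) / μ ^ 2 := div_pos (sub_pos.mpr hμ) (pow_pos hpos 2)
  refine forall₂_congr fun R hR => ?_
  rw [W_one_zero_smul hR₀ F hpos.ne', W_one_zero_smul hR F hpos.ne', add_le_add_iff_right,
    mul_le_mul_iff_right₀ hc]
end
end

section
/- (Explicit formula for the planar polar factor.) Let F ∈ GL⁺(2) and let J := [[0, −1],[1, 0]]. Then polar(F) = (1/tr U(F))·[[tr F, tr(JF)],[−tr(JF), tr F]], where tr U(F) = √(‖F‖² + 2·det F). -/
open Matrix Real

noncomputable section

/-- The determinant of the right stretch tensor is the determinant of the matrix. -/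
theorem det_eq_of_mul_self_eq {n : ℕ} {F U : Matrix (Fin n) (Fin n) ℝ} (hF : 0 < F.det)
    (hU : U.PosDef) (hUsq : U * U = Fᵀ * F) : U.det = F.det := by
  have h := congrArg Matrix.det hUsq
  rw [det_mul, det_mul, det_transpose] at h
  nlinarith [hU.det_pos]

/-- Cayley-Hamilton for real `2 × 2` matrices. -/
theorem mul_self_add_det_smul_one (A : Matrix (Fin 2) (Fin 2) ℝ) :
    A * A + A.det • (1 : Matrix (Fin 2) (Fin 2) ℝ) = A.trace • A := by
  ext i j
  fin_cases i <;> fin_cases j <;>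
    simp [Matrix.mul_apply, Fin.sum_univ_two, det_fin_two, trace_fin_two] <;> ring

/-- A real `2 × 2` matrix plus its cofactor matrix, expressed through traces. -/
theorem add_adjugate_transpose (F : Matrix (Fin 2) (Fin 2) ℝ) :
    F + F.adjugateᵀ =
      !![Matrix.trace F, Matrix.trace ((!![0, -1; 1, 0] : Matrix (Fin 2) (Fin 2) ℝ) * F);
         -Matrix.trace ((!![0, -1; 1, 0] : Matrix (Fin 2) (Fin 2) ℝ) * F), Matrix.trace F] := by
  ext i j
  fin_cases i <;> fin_cases j <;>
    simp [vecMul, dotProduct, Fin.sum_univ_two, adjugate_fin_two, trace_fin_two] <;> ring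

/-- **Explicit formula for the planar polar factor.** With J = [[0,−1],[1,0]],
polar(F) = (1/tr U(F)) • [[tr F, tr(JF)],[−tr(JF), tr F]] and
tr U(F) = √(‖F‖² + 2 det F). -/
theorem polar_factor_formula (F : Matrix (Fin 2) (Fin 2) ℝ) (hF : 0 < F.det)
    (U : Matrix (Fin 2) (Fin 2) ℝ) (hUpos : U.PosDef) (hUsq : U * U = Fᵀ * F) :
    Matrix.trace U = Real.sqrt (frobSq F + 2 * F.det) ∧
    F * U⁻¹ = (1 / Matrix.trace U) •
      !![Matrix.trace F, Matrix.trace ((!![0, -1; 1, 0] : Matrix (Fin 2) (Fin 2) ℝ) * F);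
         -Matrix.trace ((!![0, -1; 1, 0] : Matrix (Fin 2) (Fin 2) ℝ) * F), Matrix.trace F] := by
  have hdet := det_eq_of_mul_self_eq hF hUpos hUsq
  have hCH := mul_self_add_det_smul_one U
  have htr : 0 < Matrix.trace U := hUpos.trace_pos
  have hUunit : IsUnit U.det := hUpos.det_pos.ne'.isUnit
  refine ⟨?_, ?_⟩
  · have h := congrArg Matrix.trace hCH
    rw [hUsq, trace_add, trace_smul, trace_smul, trace_one, hdet] at h
    simp only [Fintype.card_fin, smul_eq_mul, Nat.cast_ofNat] at h
    rw [frobSq, mul_comm 2 F.det, h, Real.sqrt_mul_self htr.le]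
  · have hFM : Fᵀ * (F + F.adjugateᵀ) = Matrix.trace U • U := by
      rw [mul_add, ← transpose_mul, adjugate_mul, transpose_smul, transpose_one,
        ← hUsq, ← hdet, hCH]
    have hFunit : IsUnit (Fᵀ).det := by
      rw [det_transpose]
      exact hF.ne'.isUnit
    have hMU : (F + F.adjugateᵀ) * U = Matrix.trace U • F := by
      rw [← nonsing_inv_mul_cancel_left Fᵀ ((F + F.adjugateᵀ) * U) hFunit,
        ← mul_assoc Fᵀ, hFM, smul_mul_assoc, hUsq, mul_smul_comm,
        nonsing_inv_mul_cancel_left _ _ hFunit]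
    rw [← add_adjugate_transpose, ← mul_nonsing_inv_cancel_right U (F + F.adjugateᵀ) hUunit,
      hMU, smul_mul_assoc, smul_smul, one_div_mul_cancel htr.ne', one_smul]
end
end

section
/- (Symmetry of the planar first Cosserat deformation tensor.) Let F ∈ GL⁺(2) and R ∈ SO(2). Then the matrix RᵀF is symmetric if and only if R = polar(F) or R = −polar(F). -/
open Matrix Real

noncomputable section

/-- Cayley–Hamilton for `2 × 2` matrices, in explicit form. -/
lemma mul_self_eq_trace_smul_sub_det_smul (A : Matrix (Fin 2) (Fin 2) ℝ) :
    A * A = A.trace • A - A.det • (1 : Matrix (Fin 2) (Fin 2) ℝ) := by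
  ext i j
  fin_cases i <;> fin_cases j <;>
    simp [Matrix.mul_apply, Fin.sum_univ_two, Matrix.trace_fin_two, Matrix.det_fin_two] <;> ring

/-- Two `2 × 2` matrices with equal squares and equal determinants agree up to sign, provided one
of them has nonzero trace. -/
lemma eq_or_eq_neg_of_mul_self_eq {A B : Matrix (Fin 2) (Fin 2) ℝ} (hB : B.trace ≠ 0)
    (hsq : A * A = B * B) (hdet : A.det = B.det) : A = B ∨ A = -B := by
  have h : A.trace • A = B.trace • B := by
    rw [mul_self_eq_trace_smul_sub_det_smul, mul_self_eq_trace_smul_sub_det_smul B, hdet] at hsq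
    exact sub_left_injective hsq
  have ht : A.trace * A.trace = B.trace * B.trace := by
    simpa using congrArg Matrix.trace h
  rcases mul_self_eq_mul_self_iff.mp ht with h' | h'
  · left
    rw [h'] at h
    exact smul_right_injective _ hB h
  · right
    rw [h', neg_smul, ← smul_neg] at h
    rw [← smul_right_injective _ hB h, neg_neg]

/-- **Symmetry of the planar first Cosserat deformation tensor.** For F ∈ GL⁺(2)
and R ∈ SO(2), RᵀF is symmetric iff R = polar(F) or R = −polar(F). -/
theorem first_cosserat_tensor_symm (F : Matrix (Fin 2) (Fin 2) ℝ) (hF : 0 < F.det)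
    (U : Matrix (Fin 2) (Fin 2) ℝ) (hUpos : U.PosDef) (hUsq : U * U = Fᵀ * F)
    (R : Matrix (Fin 2) (Fin 2) ℝ) (hR : R ∈ SO 2) :
    (Rᵀ * F).IsSymm ↔ R = F * U⁻¹ ∨ R = -(F * U⁻¹) := by
  obtain ⟨hRR, hRdet⟩ := hR
  have hRR' : R * Rᵀ = 1 := mul_eq_one_comm.mp hRR
  have hUdet : 0 < U.det := hUpos.det_pos
  have hUunit : IsUnit U.det := hUdet.ne'.isUnit
  have hUsymm : Uᵀ = U := by
    simpa only [Matrix.conjTranspose_eq_transpose_of_trivial] using hUpos.isHermitian.eq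
  have hdet : U.det = F.det := by
    have h := congrArg Matrix.det hUsq
    rw [Matrix.det_mul, Matrix.det_mul, Matrix.det_transpose] at h
    exact (mul_self_inj hUdet.le hF.le).mp h
  constructor
  · intro hS
    have hsq : (Rᵀ * F) * (Rᵀ * F) = U * U := by
      nth_rw 1 [← hS.eq]
      rw [Matrix.transpose_mul, Matrix.transpose_transpose, Matrix.mul_assoc,
        ← Matrix.mul_assoc R, hRR', Matrix.one_mul, hUsq]
    have hSdet : (Rᵀ * F).det = U.det := by
      rw [Matrix.det_mul, Matrix.det_transpose, hRdet, one_mul, hdet]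
    have hFR : F = R * (Rᵀ * F) := by rw [← Matrix.mul_assoc, hRR', Matrix.one_mul]
    rcases eq_or_eq_neg_of_mul_self_eq hUpos.trace_pos.ne' hsq hSdet with h | h <;>
      rw [h] at hFR
    · left
      rw [hFR, Matrix.mul_nonsing_inv_cancel_right _ _ hUunit]
    · right
      rw [hFR, Matrix.mul_neg, Matrix.neg_mul, Matrix.mul_nonsing_inv_cancel_right _ _ hUunit,
        neg_neg]
  · have hpolar : (F * U⁻¹)ᵀ * F = U := by
      rw [Matrix.transpose_mul, Matrix.transpose_nonsing_inv, hUsymm, Matrix.mul_assoc, ← hUsq,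
        Matrix.nonsing_inv_mul_cancel_left _ _ hUunit]
    rintro (rfl | rfl)
    · rw [hpolar]
      exact hUsymm
    · rw [Matrix.transpose_neg, Matrix.neg_mul, hpolar]
      exact Matrix.IsSymm.neg hUsymm
end
end

section
/- (Solvability of the non-classical branch equation.) Let F ∈ GL⁺(2). Then there exists R ∈ SO(2) with tr(RᵀF) = 2 if and only if tr U(F) ≥ 2. -/
open Matrix Real

noncomputable section

/-- A linear form takes the value `r` on the unit circle iff `r ^ 2` is at most the squared norm of
its coefficient vector. -/
theorem exists_unit_circle_eq_iff (p q r : ℝ) :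
    (∃ x y : ℝ, x ^ 2 + y ^ 2 = 1 ∧ x * p + y * q = r) ↔ r ^ 2 ≤ p ^ 2 + q ^ 2 := by
  constructor
  · rintro ⟨x, y, hxy, rfl⟩
    linear_combination (p ^ 2 + q ^ 2) * hxy + sq_nonneg (x * q - y * p)
  · intro h
    rcases (add_nonneg (sq_nonneg p) (sq_nonneg q)).eq_or_lt with h0 | h0
    · have hp : p = 0 := by nlinarith [sq_nonneg p, sq_nonneg q]
      have hq : q = 0 := by nlinarith [sq_nonneg p, sq_nonneg q]
      have hr : r = 0 := by nlinarith [sq_nonneg r]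
      exact ⟨1, 0, by norm_num, by simp [hp, hr]⟩
    · set t := √(p ^ 2 + q ^ 2 - r ^ 2)
      have ht : t ^ 2 = p ^ 2 + q ^ 2 - r ^ 2 := Real.sq_sqrt (sub_nonneg.2 h)
      refine ⟨(r * p - t * q) / (p ^ 2 + q ^ 2), (r * q + t * p) / (p ^ 2 + q ^ 2), ?_, ?_⟩
      · field_simp
        linear_combination (p ^ 2 + q ^ 2) * ht
      · field_simp
        ring

theorem mem_SO_two_iff (R : Matrix (Fin 2) (Fin 2) ℝ) :
    R ∈ SO 2 ↔ ∃ x y : ℝ, x ^ 2 + y ^ 2 = 1 ∧ R = !![x, -y; y, x] := by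
  constructor
  · rintro ⟨hR, hdet⟩
    have hinv : Rᵀ = R.adjugate := by
      calc Rᵀ = Rᵀ * (R * R.adjugate) := by rw [mul_adjugate, hdet, one_smul, mul_one]
        _ = R.adjugate := by rw [← mul_assoc, hR, one_mul]
    rw [adjugate_fin_two] at hinv
    have h00 : R 0 0 = R 1 1 := by simpa using congrFun (congrFun hinv 0) 0
    have h10 : R 1 0 = -R 0 1 := by simpa using congrFun (congrFun hinv 0) 1
    rw [det_fin_two] at hdet
    refine ⟨R 0 0, R 1 0, ?_, ?_⟩
    · rw [← hdet, ← h00, h10]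
      ring
    · rw [eta_fin_two R, ← h00, h10]
      simp
  · rintro ⟨x, y, hxy, rfl⟩
    refine ⟨?_, ?_⟩
    · ext i j
      fin_cases i <;> fin_cases j <;> simp [mul_apply, Fin.sum_univ_two] <;>
        first | ring1 | linear_combination hxy
    · rw [det_fin_two_of, ← hxy]
      ring

/-- The squared trace of the right stretch tensor of `F ∈ GL⁺(2)` in terms of the entries
of `F`. -/
theorem trace_sq_of_mul_self_eq {F U : Matrix (Fin 2) (Fin 2) ℝ} (hF : 0 < F.det)
    (hUpos : U.PosDef) (hUsq : U * U = Fᵀ * F) :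
    U.trace ^ 2 = (F 0 0 + F 1 1) ^ 2 + (F 1 0 - F 0 1) ^ 2 := by
  have hdet : U.det = F.det := by
    have h := congrArg det hUsq
    rw [det_mul, det_mul, det_transpose] at h
    exact (mul_self_inj hUpos.det_pos.le hF.le).1 h
  have htr := congrArg trace hUsq
  simp only [trace_fin_two, mul_apply, transpose_apply, Fin.sum_univ_two] at htr
  rw [det_fin_two, det_fin_two] at hdet
  rw [trace_fin_two]
  linear_combination htr + 2 * hdet

/-- **Solvability of the non-classical branch equation.** There exists R ∈ SO(2)
with tr(RᵀF) = 2 iff tr U(F) ≥ 2. -/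
theorem nonclassical_branch_solvable (F : Matrix (Fin 2) (Fin 2) ℝ) (hF : 0 < F.det)
    (U : Matrix (Fin 2) (Fin 2) ℝ) (hUpos : U.PosDef) (hUsq : U * U = Fᵀ * F) :
    (∃ R ∈ SO 2, Matrix.trace (Rᵀ * F) = 2) ↔ 2 ≤ Matrix.trace U := by
  have htrace (x y : ℝ) : trace (!![x, -y; y, x]ᵀ * F)
      = x * (F 0 0 + F 1 1) + y * (F 1 0 - F 0 1) := by
    simp [trace_fin_two, mul_apply, Fin.sum_univ_two]
    ring
  rw [← sq_le_sq₀ zero_le_two hUpos.posSemidef.trace_nonneg,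
    trace_sq_of_mul_self_eq hF hUpos hUsq, ← exists_unit_circle_eq_iff]
  constructor
  · rintro ⟨R, hR, h⟩
    obtain ⟨x, y, hxy, rfl⟩ := (mem_SO_two_iff R).1 hR
    exact ⟨x, y, hxy, htrace x y ▸ h⟩
  · rintro ⟨x, y, hxy, h⟩
    exact ⟨_, (mem_SO_two_iff _).2 ⟨x, y, hxy, rfl⟩, (htrace x y).trans h⟩
end
end

section
/- (Reduced energy in terms of singular values.) Let F ∈ GL⁺(2) and let σ₁, σ₂ > 0 be the singular values of F, i.e., σ₁² + σ₂² = ‖F‖² and σ₁·σ₂ = det F. Then min_{R ∈ SO(2)} W_{1,0}(R;F) equals (σ₁ − 1)² + (σ₂ − 1)² if σ₁ + σ₂ < 2, and equals (1/2)(σ₁ − σ₂)² if σ₁ + σ₂ ≥ 2. -/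
open Matrix Real

noncomputable section

theorem rotation_mem_SO {x y : ℝ} (h : x ^ 2 + y ^ 2 = 1) : !![x, -y; y, x] ∈ SO 2 := by
  refine ⟨?_, ?_⟩
  · ext i j
    fin_cases i <;> fin_cases j <;> simp [Matrix.mul_apply, Fin.sum_univ_two] <;> linarith
  · rw [Matrix.det_fin_two_of]
    linarith

theorem exists_rotation_of_mem_SO {R : Matrix (Fin 2) (Fin 2) ℝ} (hR : R ∈ SO 2) :
    ∃ x y : ℝ, x ^ 2 + y ^ 2 = 1 ∧ R = !![x, -y; y, x] := by
  obtain ⟨horth, hdet⟩ := hR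
  have h00 := congrFun (congrFun horth 0) 0
  have h11 := congrFun (congrFun horth 1) 1
  simp only [Matrix.mul_apply, Fin.sum_univ_two, Matrix.transpose_apply,
    Matrix.one_apply_eq] at h00 h11
  rw [Matrix.det_fin_two] at hdet
  have hsq : (R 0 0 - R 1 1) ^ 2 + (R 0 1 + R 1 0) ^ 2 = 0 := by linarith
  have hdiag : R 0 0 - R 1 1 = 0 := by
    apply pow_eq_zero_iff (two_ne_zero) |>.mp
    linarith [sq_nonneg (R 0 0 - R 1 1), sq_nonneg (R 0 1 + R 1 0)]
  have hoff : R 0 1 + R 1 0 = 0 := by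
    apply pow_eq_zero_iff (two_ne_zero) |>.mp
    linarith [sq_nonneg (R 0 0 - R 1 1), sq_nonneg (R 0 1 + R 1 0)]
  refine ⟨R 0 0, R 1 0, by linarith, ?_⟩
  ext i j
  fin_cases i <;> fin_cases j <;> simp <;> linarith

theorem frobSq_fin_two (F : Matrix (Fin 2) (Fin 2) ℝ) :
    frobSq F = F 0 0 ^ 2 + F 0 1 ^ 2 + F 1 0 ^ 2 + F 1 1 ^ 2 := by
  simp only [frobSq, Matrix.trace_fin_two, Matrix.mul_apply, Fin.sum_univ_two,
    Matrix.transpose_apply]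
  ring

/-- On rotations, the energy depends on `R` only through `tr (Rᵀ F)`. -/
theorem W_one_zero_rotation (F : Matrix (Fin 2) (Fin 2) ℝ) {x y : ℝ} (h : x ^ 2 + y ^ 2 = 1) :
    W 1 0 !![x, -y; y, x] F =
      1 / 2 * (x * (F 0 0 + F 1 1) + y * (F 1 0 - F 0 1) - 2) ^ 2 +
        1 / 2 * (frobSq F - 2 * F.det) := by
  simp only [W, symPart, frobSq_fin_two, Matrix.det_fin_two]
  simp [Matrix.mul_apply, Fin.sum_univ_two]
  linear_combination (1 / 2 * ((F 0 0 - F 1 1) ^ 2 + (F 0 1 + F 1 0) ^ 2)) * h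

/-- The linear form `x p + y q` attains on the unit circle every value of modulus at most
`√(p² + q²)`. -/
theorem exists_unit_linear_eq {p q s t : ℝ} (hs : 0 < s) (hpq : p ^ 2 + q ^ 2 = s ^ 2)
    (ht : t ^ 2 ≤ s ^ 2) : ∃ x y : ℝ, x ^ 2 + y ^ 2 = 1 ∧ x * p + y * q = t := by
  have hk := Real.sq_sqrt (sub_nonneg.mpr ht)
  set k := √(s ^ 2 - t ^ 2)
  refine ⟨(p * t - q * k) / s ^ 2, (q * t + p * k) / s ^ 2, ?_, ?_⟩
  · field_simp
    linear_combination (t ^ 2 + k ^ 2) * hpq + s ^ 2 * hk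
  · field_simp
    linear_combination t * hpq

/-- **Reduced energy in the singular values of F.** If σ₁, σ₂ > 0 are the singular
values of F ∈ GL⁺(2), then min_{R ∈ SO(2)} W_{1,0}(R;F) equals
(σ₁−1)² + (σ₂−1)² if σ₁ + σ₂ < 2 and (1/2)(σ₁−σ₂)² if σ₁ + σ₂ ≥ 2. -/
theorem reduced_energy_singular_values (F : Matrix (Fin 2) (Fin 2) ℝ) (hF : 0 < F.det)
    (σ₁ σ₂ : ℝ) (hσ₁ : 0 < σ₁) (hσ₂ : 0 < σ₂)
    (hsum : σ₁ ^ 2 + σ₂ ^ 2 = frobSq F) (hprod : σ₁ * σ₂ = F.det) :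
    (σ₁ + σ₂ < 2 →
      IsLeast ((fun R => W 1 0 R F) '' SO 2) ((σ₁ - 1) ^ 2 + (σ₂ - 1) ^ 2)) ∧
    (2 ≤ σ₁ + σ₂ →
      IsLeast ((fun R => W 1 0 R F) '' SO 2) ((1 / 2) * (σ₁ - σ₂) ^ 2)) := by
  have hF2 := frobSq_fin_two F
  have hdet := Matrix.det_fin_two F
  have hs : 0 < σ₁ + σ₂ := by linarith
  have hpq : (F 0 0 + F 1 1) ^ 2 + (F 1 0 - F 0 1) ^ 2 = (σ₁ + σ₂) ^ 2 := by
    linear_combination -hsum - 2 * hprod - hF2 - 2 * hdet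
  have hconst : frobSq F - 2 * F.det = (σ₁ - σ₂) ^ 2 := by
    linear_combination -hsum + 2 * hprod
  refine ⟨fun hlt => ⟨?_, ?_⟩, fun hge => ⟨?_, ?_⟩⟩
  · obtain ⟨x, y, hxy, ht⟩ := exists_unit_linear_eq hs hpq le_rfl
    refine ⟨_, rotation_mem_SO hxy, ?_⟩
    simp only [W_one_zero_rotation F hxy, ht, hconst]
    ring
  · rintro _ ⟨R, hR, rfl⟩
    obtain ⟨x, y, hxy, rfl⟩ := exists_rotation_of_mem_SO hR
    simp only [W_one_zero_rotation F hxy, hconst]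
    have hle : x * (F 0 0 + F 1 1) + y * (F 1 0 - F 0 1) ≤ σ₁ + σ₂ := by
      refine (abs_le_of_sq_le_sq' ?_ hs.le).2
      rw [← hpq]
      linear_combination sq_nonneg (x * (F 1 0 - F 0 1) - y * (F 0 0 + F 1 1)) +
        ((F 0 0 + F 1 1) ^ 2 + (F 1 0 - F 0 1) ^ 2) * hxy
    nlinarith
  · obtain ⟨x, y, hxy, ht⟩ := exists_unit_linear_eq (t := 2) hs hpq (by gcongr)
    refine ⟨_, rotation_mem_SO hxy, ?_⟩
    simp only [W_one_zero_rotation F hxy, ht, hconst]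
    ring
  · rintro _ ⟨R, hR, rfl⟩
    obtain ⟨x, y, hxy, rfl⟩ := exists_rotation_of_mem_SO hR
    simp only [W_one_zero_rotation F hxy, hconst]
    linarith [sq_nonneg (x * (F 0 0 + F 1 1) + y * (F 1 0 - F 0 1) - 2)]
end
end

section
/- (Optimal non-classical Cosserat rotations, limit case (μ,μc) = (1,0).) Let F ∈ GL⁺(2). If tr U(F) < 2, then polar(F) is the unique minimizer of R ↦ W_{1,0}(R;F) over SO(2), i.e., the set of minimizers equals {polar(F)}. If tr U(F) ≥ 2, then, setting β := arccos(2/tr U(F)), the set of minimizers of R ↦ W_{1,0}(R;F) over SO(2) equals {polar(F)·R(β), polar(F)·R(−β)}. -/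
open Matrix Real

noncomputable section

/-- A planar rotation has the form `!![c, -s; s, c]` with `c ^ 2 + s ^ 2 = 1`. -/
lemma exists_of_mem_SO_two {S : Matrix (Fin 2) (Fin 2) ℝ} (hS : S ∈ SO 2) :
    ∃ c s : ℝ, c ^ 2 + s ^ 2 = 1 ∧ S = !![c, -s; s, c] := by
  obtain ⟨h, hdet⟩ := hS
  have h00 := congrFun (congrFun h 0) 0
  have h01 := congrFun (congrFun h 0) 1
  have h11 := congrFun (congrFun h 1) 1
  simp only [mul_apply, Fin.sum_univ_two, transpose_apply, one_apply_eq] at h00 h01 h11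
  rw [one_apply_ne (by decide)] at h01
  rw [det_fin_two] at hdet
  have hsq : (S 0 0 - S 1 1) ^ 2 + (S 0 1 + S 1 0) ^ 2 = 0 := by
    linear_combination h00 + h11 - 2 * hdet
  have hd : S 1 1 = S 0 0 := by nlinarith [sq_nonneg (S 0 0 - S 1 1), sq_nonneg (S 0 1 + S 1 0)]
  have ho : S 0 1 = -S 1 0 := by nlinarith [sq_nonneg (S 0 0 - S 1 1), sq_nonneg (S 0 1 + S 1 0)]
  refine ⟨S 0 0, S 1 0, by linear_combination h00, ?_⟩
  ext i j
  fin_cases i <;> fin_cases j <;> simp [hd, ho]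

lemma mem_SO_two_of_sq_add_sq {c s : ℝ} (h : c ^ 2 + s ^ 2 = 1) : !![c, -s; s, c] ∈ SO 2 := by
  refine ⟨?_, ?_⟩
  · ext i j
    fin_cases i <;> fin_cases j <;> simp [mul_apply, Fin.sum_univ_two] <;>
      first | ring1 | linear_combination h
  · rw [det_fin_two_of]
    linear_combination h

lemma rot_mem_SO (α : ℝ) : rot α ∈ SO 2 :=
  mem_SO_two_of_sq_add_sq (Real.cos_sq_add_sin_sq α)

lemma mul_mem_SO {n : ℕ} {Q S : Matrix (Fin n) (Fin n) ℝ} (hQ : Q ∈ SO n) (hS : S ∈ SO n) :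
    Q * S ∈ SO n := by
  refine ⟨?_, by rw [det_mul, hQ.2, hS.2, one_mul]⟩
  rw [transpose_mul, Matrix.mul_assoc, ← Matrix.mul_assoc Qᵀ, hQ.1, Matrix.one_mul, hS.1]

lemma transpose_mem_SO {n : ℕ} {Q : Matrix (Fin n) (Fin n) ℝ} (hQ : Q ∈ SO n) : Qᵀ ∈ SO n :=
  ⟨by rw [transpose_transpose]; exact mul_eq_one_comm.mp hQ.1, by rw [det_transpose, hQ.2]⟩

/-- The orthogonal factor of the right polar decomposition is a rotation. -/
lemma polar_mem_SO {n : ℕ} {F U : Matrix (Fin n) (Fin n) ℝ} (hF : 0 < F.det) (hU : U.PosDef)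
    (hUsq : U * U = Fᵀ * F) : F * U⁻¹ ∈ SO n := by
  have hdet : IsUnit U.det := hU.det_pos.ne'.isUnit
  have hsymm : Uᵀ = U := by simpa using hU.isHermitian.eq
  refine ⟨?_, ?_⟩
  · rw [transpose_mul, transpose_nonsing_inv, hsymm, Matrix.mul_assoc, ← Matrix.mul_assoc Fᵀ,
      ← hUsq, Matrix.mul_assoc U, mul_nonsing_inv _ hdet, Matrix.mul_one, nonsing_inv_mul _ hdet]
  · have h : U.det ^ 2 = F.det ^ 2 := by
      have := congrArg det hUsq
      rw [det_mul, det_mul, det_transpose] at this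
      linear_combination this
    have hUF : U.det = F.det := (sq_eq_sq₀ hU.det_pos.le hF.le).mp h
    rw [det_mul, det_nonsing_inv, Ring.inverse_eq_inv', hUF, mul_inv_cancel₀ hF.ne']

/-- For `F = Q U` with `Q` a rotation and `U` symmetric, `W_{1,0}(Q S; F)` depends on the rotation
`S` only through `(S 0 0 * tr U - 2) ^ 2`. -/
lemma W_one_zero_mul {Q U S : Matrix (Fin 2) (Fin 2) ℝ} (hQ : Q ∈ SO 2) (hU : Uᵀ = U)
    (hS : S ∈ SO 2) :
    W 1 0 (Q * S) (Q * U) =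
      ((S 0 0 * trace U - 2) ^ 2 + ((U 0 0 - U 1 1) ^ 2 + 4 * U 0 1 ^ 2)) / 2 := by
  have hX : (Q * S)ᵀ * (Q * U) = Sᵀ * U := by
    rw [transpose_mul, Matrix.mul_assoc, ← Matrix.mul_assoc Qᵀ, hQ.1, Matrix.one_mul]
  have h10 : U 1 0 = U 0 1 := congrFun (congrFun hU 0) 1
  obtain ⟨c, s, hcs, rfl⟩ := exists_of_mem_SO_two hS
  rw [W, hX]
  simp [frobSq, symPart, trace, mul_apply, Fin.sum_univ_two, h10]
  linear_combination ((U 0 0 - U 1 1) ^ 2 + 4 * U 0 1 ^ 2) / 2 * hcs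

/-- Minimizing `W_{1,0}(·; Q U)` amounts to minimizing `(S 0 0 * tr U - 2) ^ 2`. -/
lemma minimizers_eq_image {Q U : Matrix (Fin 2) (Fin 2) ℝ} (hQ : Q ∈ SO 2) (hU : Uᵀ = U) :
    {R ∈ SO 2 | ∀ R' ∈ SO 2, W 1 0 R (Q * U) ≤ W 1 0 R' (Q * U)} =
      (Q * ·) '' {S ∈ SO 2 | ∀ S' ∈ SO 2,
        (S 0 0 * trace U - 2) ^ 2 ≤ (S' 0 0 * trace U - 2) ^ 2} := by
  have hcancel (R : Matrix (Fin 2) (Fin 2) ℝ) : Q * (Qᵀ * R) = R := by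
    rw [← Matrix.mul_assoc, mul_eq_one_comm.mp hQ.1, Matrix.one_mul]
  ext R
  constructor
  · rintro ⟨hR, hmin⟩
    have hS := mul_mem_SO (transpose_mem_SO hQ) hR
    refine ⟨Qᵀ * R, ⟨hS, fun S' hS' => ?_⟩, hcancel R⟩
    have h := hmin (Q * S') (mul_mem_SO hQ hS')
    rw [← hcancel R, W_one_zero_mul hQ hU hS, W_one_zero_mul hQ hU hS'] at h
    linarith
  · rintro ⟨S, ⟨hS, hmin⟩, rfl⟩
    refine ⟨mul_mem_SO hQ hS, fun R' hR' => ?_⟩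
    have hS' := mul_mem_SO (transpose_mem_SO hQ) hR'
    rw [← hcancel R', W_one_zero_mul hQ hU hS, W_one_zero_mul hQ hU hS']
    linarith [hmin _ hS']

lemma minimizers_of_trace_lt_two {t : ℝ} (ht : 0 < t) (ht2 : t < 2) :
    {S ∈ SO 2 | ∀ S' ∈ SO 2, (S 0 0 * t - 2) ^ 2 ≤ (S' 0 0 * t - 2) ^ 2} = {1} := by
  have hone : (1 : Matrix (Fin 2) (Fin 2) ℝ) ∈ SO 2 := ⟨by simp, by simp⟩
  ext S
  rw [Set.mem_singleton_iff]
  constructor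
  · rintro ⟨hS, hmin⟩
    have h := hmin 1 hone
    obtain ⟨c, s, hcs, rfl⟩ := exists_of_mem_SO_two hS
    simp only [of_apply, cons_val_zero, one_apply_eq, one_mul] at h
    have hc1 : c ≤ 1 := by nlinarith [sq_nonneg s]
    have hc : c = 1 := by
      by_contra hne
      have hct : c * t < t := mul_lt_of_lt_one_left ht (lt_of_le_of_ne hc1 hne)
      nlinarith
    subst hc
    have hs : s = 0 := by simpa using hcs
    subst hs
    rw [one_fin_two, neg_zero]
  · rintro rfl
    refine ⟨hone, fun S' hS' => ?_⟩
    obtain ⟨c, s, hcs, rfl⟩ := exists_of_mem_SO_two hS'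
    simp only [of_apply, cons_val_zero, one_apply_eq, one_mul]
    have hc1 : c ≤ 1 := by nlinarith [sq_nonneg s]
    have hct : c * t ≤ t := mul_le_of_le_one_left ht.le hc1
    nlinarith

lemma minimizers_of_two_le_trace {t : ℝ} (ht : 2 ≤ t) :
    {S ∈ SO 2 | ∀ S' ∈ SO 2, (S 0 0 * t - 2) ^ 2 ≤ (S' 0 0 * t - 2) ^ 2} =
      {rot (Real.arccos (2 / t)), rot (-Real.arccos (2 / t))} := by
  have ht0 : 0 < t := by linarith
  have hcos : Real.cos (Real.arccos (2 / t)) = 2 / t :=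
    Real.cos_arccos (by linarith [div_pos two_pos ht0]) ((div_le_one ht0).mpr ht)
  have hzero : (2 / t * t - 2) ^ 2 = 0 := by rw [div_mul_cancel₀ _ ht0.ne', sub_self]; norm_num
  ext S
  rw [Set.mem_insert_iff, Set.mem_singleton_iff]
  constructor
  · rintro ⟨hS, hmin⟩
    have h := hmin _ (rot_mem_SO (Real.arccos (2 / t)))
    obtain ⟨c, s, hcs, rfl⟩ := exists_of_mem_SO_two hS
    simp only [rot, of_apply, cons_val_zero, hcos, hzero] at h
    have hc : c = 2 / t := by
      rw [eq_div_iff ht0.ne']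
      nlinarith
    have hs : s ^ 2 = Real.sin (Real.arccos (2 / t)) ^ 2 := by
      have := Real.cos_sq_add_sin_sq (Real.arccos (2 / t))
      rw [hcos] at this
      rw [hc] at hcs
      linarith
    rcases sq_eq_sq_iff_eq_or_eq_neg.mp hs with h | h
    · left; rw [rot, hcos, hc, h]
    · right; rw [rot, Real.cos_neg, Real.sin_neg, hcos, hc, h]
  · have hval (α : ℝ) (hα : Real.cos α = 2 / t) :
        ∀ S' ∈ SO 2, (rot α 0 0 * t - 2) ^ 2 ≤ (S' 0 0 * t - 2) ^ 2 := fun S' _ => by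
      simp only [rot, of_apply, cons_val_zero, hα, hzero]
      positivity
    rintro (rfl | rfl)
    · exact ⟨rot_mem_SO _, hval _ hcos⟩
    · exact ⟨rot_mem_SO _, hval _ (by rw [Real.cos_neg, hcos])⟩

/-- **Optimal non-classical Cosserat rotations, limit case (μ,μc) = (1,0).**
If tr U(F) < 2 the unique minimizer of W_{1,0}(·;F) over SO(2) is polar(F);
if tr U(F) ≥ 2 the minimizers are polar(F)·R(±β) with β = arccos(2/tr U(F)). -/
theorem optimal_rotations_W10 (F : Matrix (Fin 2) (Fin 2) ℝ) (hF : 0 < F.det)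
    (U : Matrix (Fin 2) (Fin 2) ℝ) (hUpos : U.PosDef) (hUsq : U * U = Fᵀ * F) :
    (Matrix.trace U < 2 →
      {R ∈ SO 2 | ∀ R' ∈ SO 2, W 1 0 R F ≤ W 1 0 R' F} = {F * U⁻¹}) ∧
    (2 ≤ Matrix.trace U →
      {R ∈ SO 2 | ∀ R' ∈ SO 2, W 1 0 R F ≤ W 1 0 R' F} =
        {(F * U⁻¹) * rot (Real.arccos (2 / Matrix.trace U)),
         (F * U⁻¹) * rot (-Real.arccos (2 / Matrix.trace U))}) := by
  have hQ := polar_mem_SO hF hUpos hUsq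
  have hsymm : Uᵀ = U := by simpa using hUpos.isHermitian.eq
  have hfac : F * U⁻¹ * U = F := by
    rw [Matrix.mul_assoc, nonsing_inv_mul _ hUpos.det_pos.ne'.isUnit, Matrix.mul_one]
  have himage := minimizers_eq_image hQ hsymm
  rw [hfac] at himage
  refine ⟨fun ht => ?_, fun ht => ?_⟩
  · rw [himage, minimizers_of_trace_lt_two hUpos.trace_pos ht, Set.image_singleton,
      Matrix.mul_one]
  · rw [himage, minimizers_of_two_le_trace ht, Set.image_pair]
end
end

section
/- (Ordering of the critical energy levels.) Let F ∈ GL⁺(2). Then ‖U(F) − 𝟙‖² ≤ ‖U(F) + 𝟙‖², and if tr U(F) ≥ 2 then moreover (1/2)‖F‖² − det F ≤ ‖U(F) − 𝟙‖². In fact, ‖U(F) − 𝟙‖² − ((1/2)‖F‖² − det F) = (tr U(F) − 2)²/2 for every F ∈ GL⁺(2). -/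
open Matrix Real

noncomputable section

theorem frobSq_add_smul_one_of_transpose_eq {n : ℕ} {U : Matrix (Fin n) (Fin n) ℝ}
    (hU : Uᵀ = U) (c : ℝ) :
    frobSq (U + c • 1) = Matrix.trace (U * U) + 2 * c * Matrix.trace U + c ^ 2 * n := by
  simp only [frobSq, transpose_add, transpose_smul, transpose_one, hU, add_mul, mul_add,
    Matrix.smul_mul, Matrix.mul_smul, one_mul, mul_one, trace_add, trace_smul, trace_one,
    Fintype.card_fin, smul_eq_mul]
  ring

theorem trace_mul_self_fin_two {R : Type*} [CommRing R] (A : Matrix (Fin 2) (Fin 2) R) :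
    Matrix.trace (A * A) = Matrix.trace A ^ 2 - 2 * A.det := by
  simp only [trace_fin_two, det_fin_two, mul_apply, Fin.sum_univ_two]
  ring

theorem det_eq_of_mul_self_eq_transpose_mul_self {n : ℕ} {U F : Matrix (Fin n) (Fin n) ℝ}
    (hU : 0 ≤ U.det) (hF : 0 ≤ F.det) (h : U * U = Fᵀ * F) : U.det = F.det := by
  have hdet := congrArg Matrix.det h
  rw [det_mul, det_mul, det_transpose] at hdet
  exact (mul_self_inj hU hF).1 hdet

/-- **Ordering of the critical energy levels.** ‖U−𝟙‖² ≤ ‖U+𝟙‖²; if tr U ≥ 2 then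
(1/2)‖F‖² − det F ≤ ‖U−𝟙‖²; and in fact
‖U−𝟙‖² − ((1/2)‖F‖² − det F) = (tr U − 2)²/2. -/
theorem critical_energy_ordering (F : Matrix (Fin 2) (Fin 2) ℝ) (hF : 0 < F.det)
    (U : Matrix (Fin 2) (Fin 2) ℝ) (hUpos : U.PosDef) (hUsq : U * U = Fᵀ * F) :
    frobSq (U - 1) ≤ frobSq (U + 1) ∧
    (2 ≤ Matrix.trace U → (1 / 2) * frobSq F - F.det ≤ frobSq (U - 1)) ∧
    frobSq (U - 1) - ((1 / 2) * frobSq F - F.det) = (Matrix.trace U - 2) ^ 2 / 2 := by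
  have hUT : Uᵀ = U := hUpos.isHermitian
  have htr : 0 < Matrix.trace U := hUpos.trace_pos
  have hdet : U.det = F.det :=
    det_eq_of_mul_self_eq_transpose_mul_self hUpos.det_pos.le hF.le hUsq
  have hsub := frobSq_add_smul_one_of_transpose_eq hUT (-1)
  have hadd := frobSq_add_smul_one_of_transpose_eq hUT 1
  rw [neg_one_smul, ← sub_eq_add_neg] at hsub
  rw [one_smul] at hadd
  push_cast at hsub hadd
  have hFsq : frobSq F = Matrix.trace (U * U) := by rw [frobSq, hUsq]
  have hsq := trace_mul_self_fin_two U
  have hgap : frobSq (U - 1) - ((1 / 2) * frobSq F - F.det) = (Matrix.trace U - 2) ^ 2 / 2 := by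
    rw [hsub, hFsq, ← hdet, hsq]
    ring
  refine ⟨by linarith, fun _ => ?_, hgap⟩
  linarith [sq_nonneg (Matrix.trace U - 2)]
end
end

section
/- (Non-classical response in simple shear.) For γ ∈ ℝ let F_γ := [[1, γ],[0, 1]]. Then tr U(F_γ) = √(4 + γ²) ≥ 2, and for every γ ≠ 0 the polar factor is not optimal: W_{1,0}(polar(F_γ); F_γ) > min_{R ∈ SO(2)} W_{1,0}(R; F_γ); in particular polar(F_γ) is not a minimizer of R ↦ W_{1,0}(R;F_γ) over SO(2). -/
open Matrix Real

noncomputable section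

/-- Cayley–Hamilton in dimension two, in traced form. -/
lemma trace_sq_eq_trace_mul_self_add_det (U : Matrix (Fin 2) (Fin 2) ℝ) :
    U.trace ^ 2 = (U * U).trace + 2 * U.det := by
  simp only [trace_fin_two, det_fin_two, mul_apply, Fin.sum_univ_two]
  ring

/-- A positive definite square root of `Fᵀ * F` has determinant `1` when `F` does. -/
lemma det_eq_one_of_mul_self_eq {n : ℕ} {U F : Matrix (Fin n) (Fin n) ℝ} (hU : U.PosDef)
    (hUsq : U * U = Fᵀ * F) (hF : F.det = 1) : U.det = 1 := by
  have h := congrArg det hUsq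
  rw [det_mul, det_mul, det_transpose, hF] at h
  nlinarith [hU.det_pos]

/-- The polar factor `F * U⁻¹` pulls `F` back to the stretch `U`. -/
lemma transpose_polar_mul {n : ℕ} {U F : Matrix (Fin n) (Fin n) ℝ} (hU : U.PosDef)
    (hUsq : U * U = Fᵀ * F) : (F * U⁻¹)ᵀ * F = U := by
  have hUt : Uᵀ = U := by
    simpa only [conjTranspose_eq_transpose_of_trivial] using hU.isHermitian.eq
  rw [transpose_mul, transpose_nonsing_inv, hUt, Matrix.mul_assoc, ← hUsq,
    nonsing_inv_mul_cancel_left _ _ hU.det_pos.ne'.isUnit]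

/-- The energy `W 1 0` at the polar factor is `‖U - 1‖²`, expanded. -/
lemma W_polar {n : ℕ} {U F : Matrix (Fin n) (Fin n) ℝ} (hU : U.PosDef)
    (hUsq : U * U = Fᵀ * F) :
    W 1 0 (F * U⁻¹) F = (U * U).trace - 2 * U.trace + n := by
  have hUt : Uᵀ = U := by
    simpa only [conjTranspose_eq_transpose_of_trivial] using hU.isHermitian.eq
  have hsym : symPart (U - 1) = U - 1 := by
    rw [symPart, transpose_sub, transpose_one, hUt, ← two_smul ℝ, smul_smul]
    norm_num
  rw [W, transpose_polar_mul hU hUsq, hsym, frobSq, transpose_sub, transpose_one, hUt]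
  simp only [Matrix.sub_mul, Matrix.mul_sub, Matrix.one_mul, Matrix.mul_one, trace_sub, trace_one,
    Fintype.card_fin]
  ring

/-- The energy of the identity rotation in simple shear. -/
lemma W_one_simple_shear (γ : ℝ) :
    W 1 0 1 (!![1, γ; 0, 1] : Matrix (Fin 2) (Fin 2) ℝ) = γ ^ 2 / 2 := by
  simp [W, frobSq, symPart, trace_fin_two, mul_apply, Fin.sum_univ_two]
  ring

lemma trace_transpose_mul_simple_shear (γ : ℝ) :
    ((!![1, γ; 0, 1] : Matrix (Fin 2) (Fin 2) ℝ)ᵀ * !![1, γ; 0, 1]).trace = 2 + γ ^ 2 := by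
  simp [trace_fin_two, mul_apply, Fin.sum_univ_two]
  ring

/-- **Non-classical response in simple shear.** For F_γ = [[1,γ],[0,1]]:
tr U(F_γ) = √(4 + γ²) ≥ 2, and for γ ≠ 0 the polar factor is strictly suboptimal
for W_{1,0}( · ; F_γ): in particular it is not a minimizer over SO(2). -/
theorem simple_shear_nonclassical (γ : ℝ)
    (U : Matrix (Fin 2) (Fin 2) ℝ) (hUpos : U.PosDef)
    (hUsq : U * U = (!![1, γ; 0, 1] : Matrix (Fin 2) (Fin 2) ℝ)ᵀ * !![1, γ; 0, 1]) :
    Matrix.trace U = Real.sqrt (4 + γ ^ 2) ∧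
    2 ≤ Matrix.trace U ∧
    (γ ≠ 0 →
      (∃ R ∈ SO 2,
        W 1 0 R (!![1, γ; 0, 1] : Matrix (Fin 2) (Fin 2) ℝ) <
          W 1 0 ((!![1, γ; 0, 1] : Matrix (Fin 2) (Fin 2) ℝ) * U⁻¹) !![1, γ; 0, 1]) ∧
      ¬ (!![1, γ; 0, 1] : Matrix (Fin 2) (Fin 2) ℝ) * U⁻¹ ∈
        {R ∈ SO 2 | ∀ R' ∈ SO 2,
          W 1 0 R (!![1, γ; 0, 1] : Matrix (Fin 2) (Fin 2) ℝ) ≤ W 1 0 R' !![1, γ; 0, 1]}) := by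
  have hdet : U.det = 1 := det_eq_one_of_mul_self_eq hUpos hUsq (by simp [det_fin_two])
  have htr : (U * U).trace = 2 + γ ^ 2 := by rw [hUsq, trace_transpose_mul_simple_shear]
  have hsq : U.trace ^ 2 = 4 + γ ^ 2 := by
    rw [trace_sq_eq_trace_mul_self_add_det, htr, hdet]
    ring
  have hpos : 0 < U.trace := hUpos.trace_pos
  refine ⟨by rw [← hsq, Real.sqrt_sq hpos.le], by nlinarith [sq_nonneg γ], fun hγ => ?_⟩
  have hone : (1 : Matrix (Fin 2) (Fin 2) ℝ) ∈ SO 2 := by simp [SO]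
  have hlt : W 1 0 1 (!![1, γ; 0, 1] : Matrix (Fin 2) (Fin 2) ℝ) <
      W 1 0 ((!![1, γ; 0, 1] : Matrix (Fin 2) (Fin 2) ℝ) * U⁻¹) !![1, γ; 0, 1] := by
    have hne : U.trace - 2 ≠ 0 := fun h => hγ <| by
      rw [sub_eq_zero.mp h] at hsq
      exact pow_eq_zero_iff two_ne_zero |>.mp (by linarith)
    rw [W_one_simple_shear, W_polar hUpos hUsq, htr]
    push_cast
    nlinarith [sq_pos_of_ne_zero hne]
  exact ⟨⟨1, hone, hlt⟩, fun h => (h.2 1 hone).not_gt hlt⟩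
end
end

section
/- (Cancellation of the polar factor in simple shear.) For γ ∈ ℝ let F_γ := [[1, γ],[0, 1]]. Then the identity matrix 𝟙 is a global minimizer of R ↦ W_{1,0}(R;F_γ) over SO(2), and W_{1,0}(𝟙; F_γ) = min_{R ∈ SO(2)} W_{1,0}(R; F_γ) = γ²/2. -/
open Matrix Real

noncomputable section

/-- A planar rotation matrix has the form `[[c, -s], [s, c]]` with `c² + s² = 1`. -/
lemma exists_eq_of_mem_SO_two {R : Matrix (Fin 2) (Fin 2) ℝ} (hR : R ∈ SO 2) :
    ∃ c s : ℝ, c ^ 2 + s ^ 2 = 1 ∧ R = !![c, -s; s, c] := by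
  obtain ⟨horth, hdet⟩ := hR
  have h00 := congrFun (congrFun horth 0) 0
  have h01 := congrFun (congrFun horth 0) 1
  simp only [Matrix.mul_apply, Matrix.transpose_apply, Fin.sum_univ_two, Matrix.one_apply_eq,
    Matrix.one_apply_ne (zero_ne_one : (0 : Fin 2) ≠ 1)] at h00 h01
  rw [Matrix.det_fin_two] at hdet
  have hd : R 1 1 = R 0 0 := by
    linear_combination -R 1 1 * h00 + R 0 0 * hdet + R 1 0 * h01
  have hb : R 0 1 = -R 1 0 := by
    linear_combination -R 0 1 * h00 + R 0 0 * h01 - R 1 0 * hdet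
  refine ⟨R 0 0, R 1 0, by linear_combination h00, ?_⟩
  rw [Matrix.eta_fin_two R]
  simp [hd, hb]

/-- The energy of a simple shear at a rotation, as a constant plus a square. -/
lemma W_one_zero_simple_shear {c s : ℝ} (h : c ^ 2 + s ^ 2 = 1) (γ : ℝ) :
    W 1 0 !![c, -s; s, c] !![1, γ; 0, 1] = γ ^ 2 / 2 + 2 * (c - 1 - s * γ / 2) ^ 2 := by
  simp [W, frobSq, symPart, Matrix.trace_fin_two, Matrix.mul_apply, Fin.sum_univ_two]
  linear_combination γ ^ 2 / 2 * h

/-- **Cancellation of the polar factor in simple shear.** For F_γ = [[1,γ],[0,1]],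
the identity is a global minimizer of W_{1,0}( · ; F_γ) over SO(2), with minimal
value γ²/2. -/
theorem simple_shear_identity_optimal (γ : ℝ) :
    IsLeast ((fun R => W 1 0 R (!![1, γ; 0, 1] : Matrix (Fin 2) (Fin 2) ℝ)) '' SO 2)
      (W 1 0 (1 : Matrix (Fin 2) (Fin 2) ℝ) !![1, γ; 0, 1]) ∧
    W 1 0 (1 : Matrix (Fin 2) (Fin 2) ℝ) !![1, γ; 0, 1] = γ ^ 2 / 2 := by
  have hone : W 1 0 (1 : Matrix (Fin 2) (Fin 2) ℝ) !![1, γ; 0, 1] = γ ^ 2 / 2 := by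
    simpa [← Matrix.one_fin_two] using W_one_zero_simple_shear (c := 1) (s := 0) (by norm_num) γ
  refine ⟨⟨⟨1, by simp [SO], rfl⟩, ?_⟩, hone⟩
  rintro _ ⟨R, hR, rfl⟩
  obtain ⟨c, s, h, rfl⟩ := exists_eq_of_mem_SO_two hR
  simp only [hone, W_one_zero_simple_shear h]
  linarith [sq_nonneg (c - 1 - s * γ / 2)]
end
end

section
/- (Cancellation of the polar factor beyond simple shear.) For γ ∈ ℝ and κ ∈ ℝ with 0 < |κ| < 1, let F_{γ,κ} := [[1 + κ, γ],[0, 1 − κ]]. Then det F_{γ,κ} = 1 − κ² > 0 (so F_{γ,κ} ∈ GL⁺(2)), tr F_{γ,κ} = 2, tr U(F_{γ,κ}) = √(4 + γ²) ≥ 2, and the identity matrix 𝟙 is a global minimizer of R ↦ W_{1,0}(R;F_{γ,κ}) over SO(2). -/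
open Matrix Real

noncomputable section

/-- **Cancellation of the polar factor beyond simple shear.** For
F_{γ,κ} = [[1+κ,γ],[0,1−κ]] with 0 < |κ| < 1: det F_{γ,κ} = 1 − κ² > 0,
tr F_{γ,κ} = 2, tr U(F_{γ,κ}) = √(4 + γ²) ≥ 2, and the identity is a global
minimizer of W_{1,0}( · ; F_{γ,κ}) over SO(2). -/
theorem beyond_simple_shear (γ κ : ℝ) (hκ0 : 0 < |κ|) (hκ1 : |κ| < 1)
    (U : Matrix (Fin 2) (Fin 2) ℝ) (hUpos : U.PosDef)
    (hUsq : U * U =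
      (!![1 + κ, γ; 0, 1 - κ] : Matrix (Fin 2) (Fin 2) ℝ)ᵀ * !![1 + κ, γ; 0, 1 - κ]) :
    (!![1 + κ, γ; 0, 1 - κ] : Matrix (Fin 2) (Fin 2) ℝ).det = 1 - κ ^ 2 ∧
    0 < (1 : ℝ) - κ ^ 2 ∧
    Matrix.trace (!![1 + κ, γ; 0, 1 - κ] : Matrix (Fin 2) (Fin 2) ℝ) = 2 ∧
    Matrix.trace U = Real.sqrt (4 + γ ^ 2) ∧
    2 ≤ Matrix.trace U ∧
    ∀ R ∈ SO 2,
      W 1 0 (1 : Matrix (Fin 2) (Fin 2) ℝ) (!![1 + κ, γ; 0, 1 - κ] : Matrix (Fin 2) (Fin 2) ℝ) ≤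
        W 1 0 R !![1 + κ, γ; 0, 1 - κ] := by
  have hκ : κ ^ 2 < 1 := (sq_lt_one_iff_abs_lt_one κ).mpr hκ1
  have htrace : U.trace = √(4 + γ ^ 2) := by
    have hdet : U.det = 1 - κ ^ 2 := by
      have h := congrArg Matrix.det hUsq
      simp only [Matrix.det_mul, Matrix.det_transpose, Matrix.det_fin_two_of] at h
      have hpos := hUpos.det_pos
      have hfac : (U.det - (1 - κ ^ 2)) * (U.det + (1 - κ ^ 2)) = 0 := by linear_combination h
      rcases mul_eq_zero.mp hfac with h0 | h0 <;> linarith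
    have hsq : U.trace ^ 2 = 4 + γ ^ 2 := by
      have h := congrArg Matrix.trace hUsq
      simp only [Matrix.trace_fin_two, Matrix.det_fin_two, Matrix.mul_apply, Fin.sum_univ_two,
        Matrix.transpose_apply, Matrix.of_apply, Matrix.cons_val_zero, Matrix.cons_val_one,
        Matrix.cons_val', Matrix.cons_val_fin_one] at h hdet ⊢
      linear_combination h + 2 * hdet
    rw [← hsq, Real.sqrt_sq hUpos.posSemidef.trace_nonneg]
  refine ⟨?_, by linarith, ?_, htrace, ?_, ?_⟩
  · rw [Matrix.det_fin_two_of]; ring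
  · rw [Matrix.trace_fin_two_of]; ring
  · rw [htrace]
    exact Real.le_sqrt_of_sq_le (by nlinarith [sq_nonneg γ])
  · rintro R ⟨hR, hdet⟩
    have h00 := congrFun₂ hR 0 0
    have h11 := congrFun₂ hR 1 1
    rw [Matrix.det_fin_two] at hdet
    simp [Matrix.mul_apply, Fin.sum_univ_two] at h00 h11
    have hsum : (R 0 0 - R 1 1) ^ 2 + (R 0 1 + R 1 0) ^ 2 = 0 := by
      linear_combination h00 + h11 - 2 * hdet
    have hd : R 1 1 = R 0 0 := by nlinarith [sq_nonneg (R 0 0 - R 1 1), sq_nonneg (R 0 1 + R 1 0)]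
    have hc : R 1 0 = -R 0 1 := by nlinarith [sq_nonneg (R 0 0 - R 1 1), sq_nonneg (R 0 1 + R 1 0)]
    rw [hd, hc] at hdet
    simp [W, frobSq, symPart, Matrix.trace_fin_two, Matrix.mul_apply, Fin.sum_univ_two, hd, hc,
      Matrix.sub_apply]
    nlinarith [sq_nonneg (2 * R 0 0 + γ * R 0 1 - 2)]
end
end
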